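/- (Theorem 3, ellipsoidal safe set) Let ε ∈ (0,1), α ∈ [0,1], f : ℝ^n → ℝ^n, g : ℝ^n → ℝ^{n×m}, and let Σ_w ∈ ℝ^{n×n} be symmetric positive definite. Let h(x) = −xᵀ E x + r with E ∈ ℝ^{n×n} symmetric positive definite and r ∈ ℝ. Fix x ∈ ℝ^n, and define w̄ ∈ ℝ^n by w̄_i = WCVaR_ε[w ↦ w_i] (over 𝒫(Σ_w)), assumed finite for each i, and assume WCVaR_ε[w ↦ wᵀ E w + 2 f(x)ᵀ E w] is finite. Suppose u ∈ ℝ^m and v ∈ ℝ^n satisfy: (1) uᵀ g(x)ᵀ E g(x) u + 2 f(x)ᵀ E g(x) u + 2 w̄ᵀ v + WCVaR_ε[w ↦ wᵀ E w + 2 f(x)ᵀ E w] + f(x)ᵀ E f(x) − r − α( xᵀ E x − r ) ≤ 0, and (2) −v ≤ E g(x) u ≤ v componentwise. Then the risk-aware CBF constraint WCVaR_ε[w ↦ −h(f(x) + g(x)u + w)] ≤ −α h(x) holds. -/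

import Mathlib

open MeasureTheory Matrix

/-- Conditional value-at-risk of a loss at level ε with respect to P. -/
noncomputable def CVaR {n : ℕ} (ε : ℝ) (P : Measure (Fin n → ℝ)) (L : (Fin n → ℝ) → ℝ) : ℝ :=
  ⨅ β : ℝ, (β + (1 / ε) * ∫ w, max (L w - β) 0 ∂P)

/-- The set of Borel probability measures on ℝ^n with finite second moments,
zero mean, and second-moment matrix Σ. -/
def Pset (n : ℕ) (S : Matrix (Fin n) (Fin n) ℝ) : Set (Measure (Fin n → ℝ)) :=
  {P | IsProbabilityMeasure P ∧ Integrable (fun w => ‖w‖ ^ 2) P ∧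
    (∀ i, ∫ w, w i ∂P = 0) ∧ ∀ i j, ∫ w, w i * w j ∂P = S i j}

/-- Worst-case CVaR over the moment set, valued in the extended reals. -/
noncomputable def WCVaR {n : ℕ} (ε : ℝ) (S : Matrix (Fin n) (Fin n) ℝ)
    (L : (Fin n → ℝ) → ℝ) : EReal :=
  ⨆ P ∈ Pset n S, ((CVaR ε P L : ℝ) : EReal)

section CVaR

variable {n : ℕ} {ε : ℝ} {P : Measure (Fin n → ℝ)} {L L₁ L₂ : (Fin n → ℝ) → ℝ}

lemma integrable_max_sub [IsProbabilityMeasure P] (hL : Integrable L P) (β : ℝ) :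
    Integrable (fun w => max (L w - β) 0) P :=
  (hL.sub (integrable_const β)).pos_part

lemma integral_le_cvar_objective (hε : ε ∈ Set.Ioo (0 : ℝ) 1) [IsProbabilityMeasure P]
    (hL : Integrable L P) (β : ℝ) :
    ∫ w, L w ∂P ≤ β + (1 / ε) * ∫ w, max (L w - β) 0 ∂P := by
  have hmono : ∫ w, (L w - β) ∂P ≤ ∫ w, max (L w - β) 0 ∂P :=
    integral_mono (hL.sub (integrable_const β)) (integrable_max_sub hL β)
      fun w => le_max_left _ _
  rw [integral_sub hL (integrable_const β)] at hmono
  simp only [integral_const, probReal_univ, one_smul] at hmono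
  have hnonneg : 0 ≤ ∫ w, max (L w - β) 0 ∂P := integral_nonneg fun w => le_max_right _ _
  have hone : 1 ≤ 1 / ε := (one_le_div hε.1).2 hε.2.le
  linarith [le_mul_of_one_le_left hnonneg hone]

lemma integral_le_CVaR (hε : ε ∈ Set.Ioo (0 : ℝ) 1) [IsProbabilityMeasure P]
    (hL : Integrable L P) : ∫ w, L w ∂P ≤ CVaR ε P L :=
  le_ciInf (integral_le_cvar_objective hε hL)

lemma CVaR_le (hε : ε ∈ Set.Ioo (0 : ℝ) 1) [IsProbabilityMeasure P]
    (hL : Integrable L P) (β : ℝ) :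
    CVaR ε P L ≤ β + (1 / ε) * ∫ w, max (L w - β) 0 ∂P :=
  ciInf_le ⟨∫ w, L w ∂P, Set.forall_mem_range.2 (integral_le_cvar_objective hε hL)⟩ β

lemma CVaR_add_le (hε : ε ∈ Set.Ioo (0 : ℝ) 1) [IsProbabilityMeasure P]
    (h₁ : Integrable L₁ P) (h₂ : Integrable L₂ P) :
    CVaR ε P (fun w => L₁ w + L₂ w) ≤ CVaR ε P L₁ + CVaR ε P L₂ := by
  refine le_ciInf_add_ciInf fun β₁ β₂ => ?_
  refine (CVaR_le hε (h₁.add h₂) (β₁ + β₂)).trans ?_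
  have hmono : ∫ w, max (L₁ w + L₂ w - (β₁ + β₂)) 0 ∂P ≤
      ∫ w, (max (L₁ w - β₁) 0 + max (L₂ w - β₂) 0) ∂P := by
    refine integral_mono (integrable_max_sub (h₁.add h₂) _)
      ((integrable_max_sub h₁ β₁).add (integrable_max_sub h₂ β₂)) fun w => max_le ?_ ?_
    · linarith [le_max_left (L₁ w - β₁) 0, le_max_left (L₂ w - β₂) 0]
    · linarith [le_max_right (L₁ w - β₁) 0, le_max_right (L₂ w - β₂) 0]
  rw [integral_add (integrable_max_sub h₁ β₁) (integrable_max_sub h₂ β₂)] at hmono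
  have := mul_le_mul_of_nonneg_left hmono (one_div_pos.2 hε.1).le
  simp only [Pi.add_apply]
  linarith

lemma CVaR_const_le (hε : ε ∈ Set.Ioo (0 : ℝ) 1) [IsProbabilityMeasure P] (c : ℝ) :
    CVaR ε P (fun _ => c) ≤ c := by
  simpa using CVaR_le hε (integrable_const c : Integrable (fun _ => c) P) c

lemma CVaR_const_mul_le (hε : ε ∈ Set.Ioo (0 : ℝ) 1) [IsProbabilityMeasure P]
    (hL : Integrable L P) {c : ℝ} (hc : 0 ≤ c) :
    CVaR ε P (fun w => c * L w) ≤ c * CVaR ε P L := by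
  rw [CVaR.eq_def ε P L, Real.mul_iInf_of_nonneg hc]
  refine le_ciInf fun β => (CVaR_le hε (hL.const_mul c) (c * β)).trans_eq ?_
  have hmax : ∀ w, max (c * L w - c * β) 0 = c * max (L w - β) 0 := fun w => by
    rw [mul_max_of_nonneg _ _ hc, mul_sub, mul_zero]
  simp only [hmax, integral_const_mul]
  ring

lemma CVaR_sum_le (hε : ε ∈ Set.Ioo (0 : ℝ) 1) [IsProbabilityMeasure P] {ι : Type*}
    (s : Finset ι) {F : ι → (Fin n → ℝ) → ℝ} (hF : ∀ i, Integrable (F i) P) :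
    CVaR ε P (fun w => ∑ i ∈ s, F i w) ≤ ∑ i ∈ s, CVaR ε P (F i) := by
  classical
  induction s using Finset.induction_on with
  | empty => simpa using CVaR_const_le (P := P) hε 0
  | insert a s ha ih =>
    simp only [Finset.sum_insert ha]
    exact (CVaR_add_le hε (hF a) (integrable_finsetSum s fun i _ => hF i)).trans
      (add_le_add_right ih _)

lemma CVaR_map_neg (L : (Fin n → ℝ) → ℝ) :
    CVaR ε (P.map (MeasurableEquiv.neg (Fin n → ℝ))) L = CVaR ε P (fun w => L (-w)) := by
  refine iInf_congr fun β => ?_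
  rw [integral_map_equiv]
  rfl

end CVaR

section Pset

variable {n : ℕ} {ε : ℝ} {S : Matrix (Fin n) (Fin n) ℝ} {P : Measure (Fin n → ℝ)}

lemma map_neg_mem_Pset (hP : P ∈ Pset n S) :
    P.map (MeasurableEquiv.neg (Fin n → ℝ)) ∈ Pset n S := by
  obtain ⟨hprob, hint, hmean, hcov⟩ := hP
  refine ⟨Measure.isProbabilityMeasure_map (MeasurableEquiv.neg _).measurable.aemeasurable,
    ?_, fun i => ?_, fun i j => ?_⟩
  · rw [integrable_map_equiv]
    simpa [Function.comp_def] using hint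
  · rw [integral_map_equiv]
    simp [integral_neg, hmean i]
  · rw [integral_map_equiv]
    simpa using hcov i j

lemma integrable_coord_mul_coord (hP : P ∈ Pset n S) (i j : Fin n) :
    Integrable (fun w => w i * w j) P := by
  refine hP.2.1.mono' (by fun_prop) (Filter.Eventually.of_forall fun w => ?_)
  rw [norm_mul, sq]
  exact mul_le_mul (norm_le_pi_norm w i) (norm_le_pi_norm w j) (norm_nonneg _) (norm_nonneg _)

lemma integrable_coord (hP : P ∈ Pset n S) (i : Fin n) : Integrable (fun w => w i) P := by
  have := hP.1
  refine ((integrable_const (1 : ℝ)).add hP.2.1).mono'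
    (measurable_pi_apply i).aestronglyMeasurable (Filter.Eventually.of_forall fun w => ?_)
  simp only [Pi.add_apply]
  nlinarith [norm_le_pi_norm w i, sq_nonneg (‖w‖ - 1)]

lemma integrable_dotProduct (hP : P ∈ Pset n S) (a : Fin n → ℝ) :
    Integrable (fun w => a ⬝ᵥ w) P :=
  integrable_finsetSum _ fun i _ => (integrable_coord hP i).const_mul (a i)

lemma integrable_quadratic (hP : P ∈ Pset n S) (E : Matrix (Fin n) (Fin n) ℝ) :
    Integrable (fun w => w ⬝ᵥ E.mulVec w) P := by
  simp only [dotProduct, mulVec, Finset.mul_sum]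
  refine integrable_finsetSum _ fun i _ => integrable_finsetSum _ fun j _ => ?_
  simpa only [mul_left_comm] using (integrable_coord_mul_coord hP i j).const_mul (E i j)

lemma CVaR_le_of_WCVaR_eq {L : (Fin n → ℝ) → ℝ} {c : ℝ} (hP : P ∈ Pset n S)
    (hc : WCVaR ε S L = (c : EReal)) : CVaR ε P L ≤ c := by
  rw [← EReal.coe_le_coe_iff, ← hc]
  exact le_iSup₂ (f := fun Q (_ : Q ∈ Pset n S) => ((CVaR ε Q L : ℝ) : EReal)) P hP

/-- The reflection symmetry of the moment set makes the bound insensitive to the sign of `b i`. -/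
lemma CVaR_dotProduct_le (hε : ε ∈ Set.Ioo (0 : ℝ) 1) (hP : P ∈ Pset n S)
    {wbar b v : Fin n → ℝ}
    (hwbar : ∀ i, WCVaR ε S (fun w => w i) = ((wbar i : ℝ) : EReal))
    (hb : ∀ i, |b i| ≤ v i) :
    CVaR ε P (fun w => b ⬝ᵥ w) ≤ wbar ⬝ᵥ v := by
  have := hP.1
  refine (CVaR_sum_le hε Finset.univ fun i => (integrable_coord hP i).const_mul (b i)).trans ?_
  refine Finset.sum_le_sum fun i _ => ?_
  have hpos : CVaR ε P (fun w => w i) ≤ wbar i := CVaR_le_of_WCVaR_eq hP (hwbar i)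
  have hneg : CVaR ε P (fun w => -w i) ≤ wbar i :=
    (CVaR_map_neg fun w => w i).symm.trans_le
      (CVaR_le_of_WCVaR_eq (map_neg_mem_Pset hP) (hwbar i))
  have hnonneg : 0 ≤ wbar i :=
    (hP.2.2.1 i).symm.trans_le ((integral_le_CVaR hε (integrable_coord hP i)).trans hpos)
  have habs : CVaR ε P (fun w => b i * w i) ≤ |b i| * wbar i := by
    rcases le_total 0 (b i) with h | h
    · rw [abs_of_nonneg h]
      exact (CVaR_const_mul_le hε (integrable_coord hP i) h).trans
        (mul_le_mul_of_nonneg_left hpos h)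
    · rw [abs_of_nonpos h]
      have hmul := CVaR_const_mul_le hε (integrable_coord hP i).neg (neg_nonneg.2 h)
      simp only [Pi.neg_apply, neg_mul_neg] at hmul
      exact hmul.trans (mul_le_mul_of_nonneg_left hneg (neg_nonneg.2 h))
  exact habs.trans ((mul_le_mul_of_nonneg_right (hb i) hnonneg).trans_eq (mul_comm _ _))

end Pset

lemma Matrix.IsSymm.dotProduct_mulVec_comm {n : ℕ} {E : Matrix (Fin n) (Fin n) ℝ}
    (hE : E.IsSymm) (a b : Fin n → ℝ) : a ⬝ᵥ E.mulVec b = b ⬝ᵥ E.mulVec a := by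
  rw [dotProduct_mulVec, ← mulVec_transpose, hE.eq, dotProduct_comm]

/-- (Theorem 3, ellipsoidal safe set) For the barrier function h(x) = −xᵀEx + r
with E symmetric positive definite, the explicit quadratic and linear conditions
on (u, v) are sufficient for the risk-aware CBF constraint. -/
theorem ellipsoid_cbf {n m : ℕ} (ε : ℝ) (hε : ε ∈ Set.Ioo (0 : ℝ) 1)
    (α : ℝ) (hα : α ∈ Set.Icc (0 : ℝ) 1)
    (f : (Fin n → ℝ) → (Fin n → ℝ)) (g : (Fin n → ℝ) → Matrix (Fin n) (Fin m) ℝ)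
    (Sw : Matrix (Fin n) (Fin n) ℝ) (hSw : Sw.PosDef)
    (E : Matrix (Fin n) (Fin n) ℝ) (hE : E.PosDef) (r : ℝ)
    (x : Fin n → ℝ) (u : Fin m → ℝ) (v : Fin n → ℝ)
    (wbar : Fin n → ℝ)
    (hwbar : ∀ i, WCVaR ε Sw (fun w => w i) = ((wbar i : ℝ) : EReal))
    (cvq : ℝ)
    (hcvq : WCVaR ε Sw (fun w => w ⬝ᵥ E.mulVec w + 2 * (f x ⬝ᵥ E.mulVec w)) =
      ((cvq : ℝ) : EReal))
    (h1 : (g x).mulVec u ⬝ᵥ E.mulVec ((g x).mulVec u) +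
        2 * (f x ⬝ᵥ E.mulVec ((g x).mulVec u)) + 2 * (wbar ⬝ᵥ v) + cvq +
        f x ⬝ᵥ E.mulVec (f x) - r - α * (x ⬝ᵥ E.mulVec x - r) ≤ 0)
    (h2 : ∀ i, -v i ≤ E.mulVec ((g x).mulVec u) i ∧ E.mulVec ((g x).mulVec u) i ≤ v i) :
    WCVaR ε Sw
        (fun w => -(-( (f x + (g x).mulVec u + w) ⬝ᵥ E.mulVec (f x + (g x).mulVec u + w)) + r)) ≤
      ((-(α * (-(x ⬝ᵥ E.mulVec x) + r)) : ℝ) : EReal) := by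
  have hsymm : E.IsSymm := by simpa using hE.isHermitian
  refine iSup₂_le fun P hP => EReal.coe_le_coe_iff.2 ?_
  have := hP.1
  set a := f x
  set d := (g x).mulVec u
  have hq : Integrable (fun w => w ⬝ᵥ E.mulVec w + 2 * (a ⬝ᵥ E.mulVec w)) P := by
    refine (integrable_quadratic hP E).add (Integrable.const_mul ?_ 2)
    simpa only [dotProduct_mulVec] using integrable_dotProduct hP (a ᵥ* E)
  have hl : Integrable (fun w => E.mulVec d ⬝ᵥ w) P := integrable_dotProduct hP _
  have hexpand : (fun w => -(-((a + d + w) ⬝ᵥ E.mulVec (a + d + w)) + r)) = fun w =>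
      ((w ⬝ᵥ E.mulVec w + 2 * (a ⬝ᵥ E.mulVec w)) + 2 * (E.mulVec d ⬝ᵥ w)) +
        (d ⬝ᵥ E.mulVec d + 2 * (a ⬝ᵥ E.mulVec d) + a ⬝ᵥ E.mulVec a - r) := by
    funext w
    simp only [mulVec_add, add_dotProduct, dotProduct_add]
    rw [dotProduct_comm (E.mulVec d) w, hsymm.dotProduct_mulVec_comm d a,
      hsymm.dotProduct_mulVec_comm w a, hsymm.dotProduct_mulVec_comm d w]
    ring
  rw [hexpand]
  have hconst := CVaR_add_le hε
    (L₁ := fun w => (w ⬝ᵥ E.mulVec w + 2 * (a ⬝ᵥ E.mulVec w)) + 2 * (E.mulVec d ⬝ᵥ w))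
    (hq.add (hl.const_mul 2))
    (integrable_const (d ⬝ᵥ E.mulVec d + 2 * (a ⬝ᵥ E.mulVec d) + a ⬝ᵥ E.mulVec a - r))
  have hadd := CVaR_add_le hε hq (hl.const_mul 2)
  have hmul := CVaR_const_mul_le hε hl zero_le_two
  have hlin := CVaR_dotProduct_le hε hP hwbar fun i => abs_le.2 (h2 i)
  have hquad := CVaR_le_of_WCVaR_eq hP hcvq
  have hc := CVaR_const_le (P := P) hε
    (d ⬝ᵥ E.mulVec d + 2 * (a ⬝ᵥ E.mulVec d) + a ⬝ᵥ E.mulVec a - r)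
  linarith
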